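/- Let ρ > 0, let X, Y ⊂ ℝ³ be bounded measurable sets forming a non-admissible pair, i.e., dist(X,Y) < ρ max{diam X, diam Y}, and let r := (2+ρ) max{diam X, diam Y}. Suppose G : X × Y → ℝ is measurable and satisfies |G(x,y)| ≤ c M / ‖x − y‖₂ for almost every (x,y) ∈ X × Y with x ≠ y, for constants c, M ≥ 0. Then ‖G‖_{L²(X×Y)}² ≤ (2π²/(3(2+ρ)³)) c² r⁴ M². -/

import Mathlib

open MeasureTheory

/-- A set in Euclidean `n`-space fits into a cube whose side is the diameter of the set. -/
theorem EuclideanSpace.volume_le_ediam_pow {ι : Type*} [Fintype ι] (s : Set (EuclideanSpace ℝ ι)) :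
    volume s ≤ Metric.ediam s ^ Fintype.card ι := by
  have h := (PiLp.volume_preserving_toLp ι).measure_preimage_equiv
    (f := MeasurableEquiv.toLp 2 (ι → ℝ)) s
  have himage : (MeasurableEquiv.toLp 2 (ι → ℝ)) ⁻¹' s = WithLp.ofLp '' s := by
    ext x
    constructor
    · intro hx
      exact ⟨WithLp.toLp 2 x, hx, rfl⟩
    · rintro ⟨y, hy, rfl⟩
      exact hy
  rw [← h, himage]
  refine (Real.volume_pi_le_diam_pow _).trans ?_
  gcongr
  simpa using (PiLp.lipschitzWith_ofLp 2 (fun _ : ι => ℝ)).ediam_image_le s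

theorem Bornology.IsBounded.volume_le_ofReal_diam_pow {s : Set (EuclideanSpace ℝ (Fin 3))}
    (hs : Bornology.IsBounded s) : volume s ≤ ENNReal.ofReal (Metric.diam s ^ 3) := by
  rw [ENNReal.ofReal_pow Metric.diam_nonneg, Metric.diam, ENNReal.ofReal_toReal hs.ediam_ne_top]
  simpa using EuclideanSpace.volume_le_ediam_pow s

theorem lintegral_ball_inv_sq_norm {s : ℝ} (hs : 0 ≤ s) :
    ∫⁻ x in Metric.ball (0 : EuclideanSpace ℝ (Fin 3)) s, ENNReal.ofReal ((‖x‖ ^ 2)⁻¹)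
      = ENNReal.ofReal (4 * Real.pi * s) := by
  have hEq : Set.EqOn (fun t : ℝ => t ^ 2 • (t ^ 2)⁻¹) (fun _ => 1) (Set.Ioo 0 s) := by
    intro t ht
    have := ht.1.ne'
    simp [this]
  have hint : IntegrableOn (fun x : EuclideanSpace ℝ (Fin 3) => (‖x‖ ^ 2)⁻¹)
      (Metric.ball 0 s) := by
    rw [integrableOn_fun_norm_addHaar volume (f := fun t : ℝ => (t ^ 2)⁻¹)]
    simp only [finrank_euclideanSpace, Fintype.card_fin, Nat.add_one_sub_one]
    rw [integrableOn_congr_fun hEq measurableSet_Ioo]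
    simp
  rw [← ofReal_integral_eq_lintegral_ofReal hint (ae_of_all _ fun x => by positivity)]
  congr 1
  have hball : (Metric.ball (0 : EuclideanSpace ℝ (Fin 3)) s).indicator (fun x => (‖x‖ ^ 2)⁻¹)
      = fun x => (Set.Iio s).indicator (fun t : ℝ => (t ^ 2)⁻¹) ‖x‖ := by
    ext x
    simp [Set.indicator]
  rw [← integral_indicator measurableSet_ball, hball, integral_fun_norm_addHaar volume]
  have hind : Set.EqOn
      (fun t : ℝ => t ^ 2 • (Set.Iio s).indicator (fun t : ℝ => (t ^ 2)⁻¹) t)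
      ((Set.Iio s).indicator fun _ => (1 : ℝ)) (Set.Ioi 0) := by
    intro t ht
    have := (Set.mem_Ioi.mp ht).ne'
    by_cases h : t < s <;> simp [Set.indicator, h, this]
  simp only [finrank_euclideanSpace, Fintype.card_fin, Nat.add_one_sub_one]
  rw [setIntegral_congr_fun measurableSet_Ioi hind, setIntegral_indicator measurableSet_Iio,
    Set.Ioi_inter_Iio, measureReal_def, EuclideanSpace.volume_ball_fin_three]
  have hpi : (ENNReal.ofReal (Real.pi * 4 / 3)).toReal = Real.pi * 4 / 3 :=
    ENNReal.toReal_ofReal (by positivity)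
  simp [hs, hpi]
  ring

/-- The Newton-type kernel `‖x - y‖⁻²` integrated over a set, split at distance `s` from `y`. -/
theorem setLIntegral_inv_sq_norm_sub_le (X : Set (EuclideanSpace ℝ (Fin 3)))
    (y : EuclideanSpace ℝ (Fin 3)) {s : ℝ} (hs : 0 < s) :
    ∫⁻ x in X, ENNReal.ofReal ((‖x - y‖ ^ 2)⁻¹)
      ≤ ENNReal.ofReal (4 * Real.pi * s) + ENNReal.ofReal ((s ^ 2)⁻¹) * volume X := by
  have hball : ∫⁻ x, (Metric.ball y s).indicator
      (fun x => ENNReal.ofReal ((‖x - y‖ ^ 2)⁻¹)) x = ENNReal.ofReal (4 * Real.pi * s) := by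
    rw [← lintegral_ball_inv_sq_norm hs.le, ← lintegral_indicator measurableSet_ball,
      ← lintegral_sub_right_eq_self (Set.indicator (Metric.ball 0 s) _) y]
    congr 1
    ext x
    simp [Set.indicator, dist_eq_norm]
  calc ∫⁻ x in X, ENNReal.ofReal ((‖x - y‖ ^ 2)⁻¹)
      ≤ ∫⁻ x in X, ((Metric.ball y s).indicator
          (fun x => ENNReal.ofReal ((‖x - y‖ ^ 2)⁻¹)) x + ENNReal.ofReal ((s ^ 2)⁻¹)) := by
        refine lintegral_mono fun x => ?_
        by_cases hx : x ∈ Metric.ball y s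
        · simp [hx]
        · simp only [Set.indicator_of_notMem hx, zero_add]
          rw [Metric.mem_ball, dist_eq_norm, not_lt] at hx
          gcongr
    _ = (∫⁻ x in X, (Metric.ball y s).indicator
          (fun x => ENNReal.ofReal ((‖x - y‖ ^ 2)⁻¹)) x)
          + ENNReal.ofReal ((s ^ 2)⁻¹) * volume X := by
        rw [lintegral_add_right _ measurable_const, setLIntegral_const]
    _ ≤ _ := by
        gcongr
        exact (setLIntegral_le_lintegral _ _).trans hball.le

theorem ae_fst_ne_snd {α : Type*} [MeasurableSpace α] [MeasurableEq α] (μ ν : Measure α)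
    [SFinite ν] [NullSingletonClass ν] : ∀ᵐ p ∂μ.prod ν, p.1 ≠ p.2 := by
  have hdiag : MeasurableSet {p : α × α | ¬ p.1 ≠ p.2} := by
    simpa only [not_not] using measurableSet_eq_fun measurable_fst measurable_snd
  rw [ae_iff, Measure.measure_prod_null hdiag]
  refine ae_of_all _ fun x => ?_
  simp

theorem setLIntegral_prod_inv_sq_norm_sub_le {X Y : Set (EuclideanSpace ℝ (Fin 3))}
    (hX : Bornology.IsBounded X) (hY : Bornology.IsBounded Y) {d : ℝ}
    (hXd : Metric.diam X ≤ d) (hYd : Metric.diam Y ≤ d) :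
    ∫⁻ p in X ×ˢ Y, ENNReal.ofReal ((‖p.1 - p.2‖ ^ 2)⁻¹)
      ≤ ENNReal.ofReal ((2 * Real.pi + 4) * d ^ 4) := by
  have hd : 0 ≤ d := Metric.diam_nonneg.trans hXd
  have hXv : volume X ≤ ENNReal.ofReal (d ^ 3) := hX.volume_le_ofReal_diam_pow.trans (by gcongr)
  have hYv : volume Y ≤ ENNReal.ofReal (d ^ 3) := hY.volume_le_ofReal_diam_pow.trans (by gcongr)
  obtain ⟨s, hs, hsd⟩ : ∃ s : ℝ, 0 < s ∧
      (4 * Real.pi * s + (s ^ 2)⁻¹ * d ^ 3) * d ^ 3 = (2 * Real.pi + 4) * d ^ 4 := by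
    rcases hd.eq_or_lt with rfl | hd
    · exact ⟨1, one_pos, by simp⟩
    · exact ⟨d / 2, by positivity, by field_simp; ring⟩
  have hmeas : Measurable fun p : EuclideanSpace ℝ (Fin 3) × EuclideanSpace ℝ (Fin 3) =>
      ENNReal.ofReal ((‖p.1 - p.2‖ ^ 2)⁻¹) := by fun_prop
  rw [Measure.volume_eq_prod, ← Measure.prod_restrict, lintegral_prod_symm _ hmeas.aemeasurable]
  calc ∫⁻ y in Y, ∫⁻ x in X, ENNReal.ofReal ((‖x - y‖ ^ 2)⁻¹)
      ≤ ∫⁻ _ in Y, ENNReal.ofReal (4 * Real.pi * s + (s ^ 2)⁻¹ * d ^ 3) := by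
        refine lintegral_mono fun y => (setLIntegral_inv_sq_norm_sub_le X y hs).trans ?_
        rw [ENNReal.ofReal_add (by positivity) (by positivity),
          ENNReal.ofReal_mul (p := (s ^ 2)⁻¹) (by positivity)]
        gcongr
    _ ≤ ENNReal.ofReal (4 * Real.pi * s + (s ^ 2)⁻¹ * d ^ 3) * ENNReal.ofReal (d ^ 3) := by
        rw [setLIntegral_const]
        gcongr
    _ = _ := by rw [← ENNReal.ofReal_mul (by positivity), hsd]

/-- Let `ρ > 0`, let `X, Y ⊂ ℝ³` be bounded measurable sets forming a
non-admissible pair, i.e. `dist(X,Y) < ρ max{diam X, diam Y}`, and let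
`r := (2+ρ) max{diam X, diam Y}`. If `G : X × Y → ℝ` is measurable and satisfies
`|G(x,y)| ≤ c M / ‖x − y‖₂` for almost every `(x,y) ∈ X × Y` with `x ≠ y`, then
`‖G‖²_{L²(X×Y)} ≤ (2π²/(3(2+ρ)³)) c² r⁴ M²`. -/
theorem stmt_15 (ρ : ℝ) (hρ : 0 < ρ)
    (X Y : Set (EuclideanSpace ℝ (Fin 3)))
    (hXm : MeasurableSet X) (hYm : MeasurableSet Y)
    (hXb : Bornology.IsBounded X) (hYb : Bornology.IsBounded Y)
    (hnonadm : sInf (Set.image2 dist X Y) < ρ * max (Metric.diam X) (Metric.diam Y))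
    (r : ℝ) (hr : r = (2 + ρ) * max (Metric.diam X) (Metric.diam Y))
    (G : EuclideanSpace ℝ (Fin 3) → EuclideanSpace ℝ (Fin 3) → ℝ)
    (hGmeas : Measurable fun p : EuclideanSpace ℝ (Fin 3) × EuclideanSpace ℝ (Fin 3) =>
      G p.1 p.2)
    (c M : ℝ) (hc : 0 ≤ c) (hM : 0 ≤ M)
    (hGbound : ∀ᵐ p ∂(volume.restrict (X ×ˢ Y)),
      p.1 ≠ p.2 → |G p.1 p.2| ≤ c * M / ‖p.1 - p.2‖) :
    ∫ p in X ×ˢ Y, (G p.1 p.2) ^ 2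
      ≤ 2 * Real.pi ^ 2 / (3 * (2 + ρ) ^ 3) * c ^ 2 * r ^ 4 * M ^ 2 := by
  set d := max (Metric.diam X) (Metric.diam Y)
  have hd : 0 ≤ d := Metric.diam_nonneg.trans (le_max_left _ _)
  have hne : ∀ᵐ p ∂(volume.restrict (X ×ˢ Y)), p.1 ≠ p.2 := by
    rw [Measure.volume_eq_prod]
    exact ae_restrict_of_ae (ae_fst_ne_snd volume volume)
  have hbound : ∫⁻ p in X ×ˢ Y, ENNReal.ofReal (G p.1 p.2 ^ 2)
      ≤ ENNReal.ofReal ((c * M) ^ 2 * ((2 * Real.pi + 4) * d ^ 4)) := by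
    calc ∫⁻ p in X ×ˢ Y, ENNReal.ofReal (G p.1 p.2 ^ 2)
        ≤ ∫⁻ p in X ×ˢ Y,
            ENNReal.ofReal ((c * M) ^ 2) * ENNReal.ofReal ((‖p.1 - p.2‖ ^ 2)⁻¹) := by
          refine lintegral_mono_ae ?_
          filter_upwards [hGbound, hne] with p hp hpne
          rw [← ENNReal.ofReal_mul (by positivity), ← sq_abs, ← div_eq_mul_inv, ← div_pow]
          gcongr
          exact hp hpne
      _ ≤ _ := by
          rw [lintegral_const_mul' _ _ ENNReal.ofReal_ne_top, ENNReal.ofReal_mul (by positivity)]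
          gcongr
          exact setLIntegral_prod_inv_sq_norm_sub_le hXb hYb (le_max_left _ _) (le_max_right _ _)
  have hpi : 2 * Real.pi + 4 ≤ 2 * Real.pi ^ 2 / 3 * (2 + ρ) := by
    nlinarith [Real.pi_gt_three, Real.pi_gt_d2, sq_nonneg Real.pi,
      mul_pos (pow_pos Real.pi_pos 2) hρ]
  rw [integral_eq_lintegral_of_nonneg_ae (ae_of_all _ fun p => sq_nonneg _)
    (hGmeas.pow_const 2).aestronglyMeasurable]
  calc _ ≤ (c * M) ^ 2 * ((2 * Real.pi + 4) * d ^ 4) :=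
        ENNReal.toReal_le_of_le_ofReal (by positivity) hbound
    _ ≤ (c * M) ^ 2 * ((2 * Real.pi ^ 2 / 3 * (2 + ρ)) * d ^ 4) := by gcongr
    _ = _ := by
        rw [hr]
        field_simp
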